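/- arXiv:2011.00142 — 4 statements merged into one kernel-verified Lean document; each statement's English description precedes it below -/
import Mathlib

section
/- Let a, b : ℕ → F be sequences with ‖a_i‖ → 0 and ‖b_i‖ → 0 such that b_i − b_i^q = a_i for all i. If ‖a_i‖^{1/i} → 0 as i → ∞, then ‖b_i‖^{1/i} → 0 as i → ∞. (Inverse images under ℘ of coefficient sequences of entire functions are again coefficient sequences of entire functions: the analytic half of Lemma 1.1(4).) -/
/-- In an ultrametric normed field, `x - x ^ q` has the same norm as `x` whenever `‖x‖ < 1`
and `1 < q`. -/
theorem norm_sub_pow_eq_norm {F : Type*} [NormedField F] [IsUltrametricDist F] {q : ℕ}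
    (hq : 1 < q) {x : F} (hx : ‖x‖ < 1) : ‖x - x ^ q‖ = ‖x‖ := by
  rcases eq_or_ne x 0 with rfl | hx0
  · simp [(zero_lt_one.trans hq).ne']
  · have hlt : ‖-x ^ q‖ < ‖x‖ := by
      rw [norm_neg, norm_pow]
      exact pow_lt_self_of_lt_one₀ (norm_pos_iff.mpr hx0) hx hq
    rw [sub_eq_add_neg, IsUltrametricDist.norm_add_eq_max_of_norm_ne_norm hlt.ne',
      max_eq_left hlt.le]


/-- If null sequences `a`, `b` satisfy `b_i - b_i^q = a_i` for all `i`, and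
`‖a_i‖^{1/i} → 0` (i.e. `∑ a_i t^i` is entire), then `‖b_i‖^{1/i} → 0` as well:
inverse images under `℘` of entire coefficient sequences are entire. -/
theorem stmt_5 {p s q : ℕ} (hp : p.Prime) (hs : 0 < s) (hq : q = p ^ s)
    {F : Type*} [NormedField F] [CompleteSpace F] [IsUltrametricDist F] [CharP F p]
    (a b : ℕ → F)
    (ha : Filter.Tendsto (fun i => ‖a i‖) Filter.atTop (nhds 0))
    (hb : Filter.Tendsto (fun i => ‖b i‖) Filter.atTop (nhds 0))
    (hab : ∀ i, b i - (b i) ^ q = a i)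
    (hent : Filter.Tendsto (fun i : ℕ => ‖a i‖ ^ (1 / (i : ℝ))) Filter.atTop (nhds 0)) :
    Filter.Tendsto (fun i : ℕ => ‖b i‖ ^ (1 / (i : ℝ))) Filter.atTop (nhds 0) := by
  have hq1 : 1 < q := hq ▸ Nat.one_lt_pow hs.ne' hp.one_lt
  refine hent.congr' ?_
  filter_upwards [hb.eventually (gt_mem_nhds one_pos)] with i hi
  rw [← hab i, norm_sub_pow_eq_norm hq1 hi]
end

section
/- The map L defined on the open unit ball {z ∈ F : ‖z‖ < 1} by L(z) = ∑_{i=0}^∞ z^{q^i} is well defined (the series converges), maps the open unit ball to itself, is additive (L(z + w) = L(z) + L(w)), satisfies L(c·z) = c·L(z) for every c ∈ F with c^q = c, is an isometry (‖L(z)‖ = ‖z‖ for all z), and is a bijection of the open unit ball onto itself with inverse given by b ↦ b − b^q. -/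
/-- The map `L(z) = ∑_{i≥0} z^{q^i}` (the value `𝔏i₀(z)` of the paper). -/
noncomputable def ASLog (q : ℕ) {F : Type*} [NormedField F] (z : F) : F :=
  ∑' i : ℕ, z ^ q ^ i

section ASLog

variable {F : Type*} [NormedField F]

theorem summable_pow_pow_of_norm_lt_one [CompleteSpace F] {q : ℕ} (hq : 1 < q) {z : F}
    (hz : ‖z‖ < 1) : Summable (fun i : ℕ => z ^ q ^ i) := by
  refine Summable.of_norm_bounded (summable_geometric_of_lt_one (norm_nonneg z) hz) fun i => ?_
  rw [norm_pow]
  exact pow_le_pow_of_le_one (norm_nonneg z) hz.le (Nat.lt_pow_self hq).le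

theorem ASLog_eq_add_tsum [CompleteSpace F] {q : ℕ} (hq : 1 < q) {z : F} (hz : ‖z‖ < 1) :
    ASLog q z = z + ∑' i : ℕ, z ^ q ^ (i + 1) := by
  rw [ASLog, (summable_pow_pow_of_norm_lt_one hq hz).tsum_eq_zero_add, pow_zero, pow_one]

theorem norm_ASLog_le [IsUltrametricDist F] {q : ℕ} (hq : 0 < q) {z : F} (hz : ‖z‖ < 1) :
    ‖ASLog q z‖ ≤ ‖z‖ := by
  refine IsUltrametricDist.norm_tsum_le_of_forall_le_of_nonneg (norm_nonneg z) fun i => ?_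
  rw [norm_pow]
  exact pow_le_of_le_one (norm_nonneg z) hz.le (pow_pos hq i).ne'

theorem norm_sub_pow_of_norm_lt_one [IsUltrametricDist F] {q : ℕ} (hq : 1 < q) {b : F}
    (hb : ‖b‖ < 1) : ‖b - b ^ q‖ = ‖b‖ := by
  rcases eq_or_ne b 0 with rfl | h0
  · simp [(zero_lt_one.trans hq).ne']
  have hlt : ‖b ^ q‖ < ‖b‖ := by
    rw [norm_pow]
    exact pow_lt_self_of_lt_one₀ (norm_pos_iff.mpr h0) hb hq
  rw [sub_eq_add_neg, IsUltrametricDist.norm_add_eq_max_of_norm_ne_norm (by simpa using hlt.ne'),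
    norm_neg, max_eq_left hlt.le]

variable {p : ℕ} [Fact p.Prime] [CharP F p]

theorem ASLog_add [CompleteSpace F] (s : ℕ) (hq : 1 < p ^ s) {z w : F} (hz : ‖z‖ < 1)
    (hw : ‖w‖ < 1) : ASLog (p ^ s) (z + w) = ASLog (p ^ s) z + ASLog (p ^ s) w := by
  simp only [ASLog]
  rw [← (summable_pow_pow_of_norm_lt_one hq hz).tsum_add (summable_pow_pow_of_norm_lt_one hq hw)]
  exact tsum_congr fun i => by rw [← pow_mul, add_pow_char_pow]

theorem ASLog_pow [CompleteSpace F] (s : ℕ) (hq : 1 < p ^ s) {z : F} (hz : ‖z‖ < 1) :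
    ASLog (p ^ s) z ^ p ^ s = ∑' i : ℕ, z ^ (p ^ s) ^ (i + 1) := by
  have h := (summable_pow_pow_of_norm_lt_one hq hz).hasSum.map (iterateFrobenius F p s)
    (continuous_pow (p ^ s))
  simp only [Function.comp_def, iterateFrobenius_def] at h
  simp only [pow_succ (p ^ s), pow_mul z]
  exact h.tsum_eq.symm

theorem ASLog_sub_pow_self [CompleteSpace F] (s : ℕ) (hq : 1 < p ^ s) {z : F} (hz : ‖z‖ < 1) :
    ASLog (p ^ s) z - ASLog (p ^ s) z ^ p ^ s = z := by
  rw [ASLog_pow s hq hz, ASLog_eq_add_tsum hq hz, add_sub_cancel_right]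

theorem ASLog_sub_pow [CompleteSpace F] (s : ℕ) (hq : 1 < p ^ s) {b : F} (hb : ‖b‖ < 1) :
    ASLog (p ^ s) (b - b ^ p ^ s) = b := by
  have hsum := summable_pow_pow_of_norm_lt_one hq hb
  have hterm (i : ℕ) :
      (b - b ^ p ^ s) ^ (p ^ s) ^ i = b ^ (p ^ s) ^ i - b ^ (p ^ s) ^ (i + 1) := by
    rw [pow_succ', pow_mul b, ← pow_mul p, sub_pow_char_pow]
  rw [ASLog, tsum_congr hterm, hsum.tsum_sub ((summable_nat_add_iff 1).mpr hsum),
    hsum.tsum_eq_zero_add, add_sub_cancel_right, pow_zero, pow_one]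

end ASLog

theorem ASLog_mul_of_pow_eq {F : Type*} [NormedField F] {q : ℕ} {c : F} (hc : c ^ q = c)
    (z : F) : ASLog q (c * z) = c * ASLog q z := by
  have hci (i : ℕ) : c ^ q ^ i = c := by
    induction i with
    | zero => simp
    | succ i ih => rw [pow_succ, pow_mul, ih, hc]
  simp only [ASLog, mul_pow, hci, tsum_mul_left]

/-- On the open unit ball of `F`, `L(z) = ∑ z^{q^i}` is a well-defined
(convergent) series, maps the ball into itself, is additive, is `𝔽_q`-linear (commutes
with multiplication by `c` with `c^q = c`), is an isometry, and is a bijection of the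
open unit ball onto itself with inverse `b ↦ b - b^q`. -/
theorem stmt_6 {p s q : ℕ} (hp : p.Prime) (hs : 0 < s) (hq : q = p ^ s)
    {F : Type*} [NormedField F] [CompleteSpace F] [IsUltrametricDist F] [CharP F p] :
    (∀ z : F, ‖z‖ < 1 → Summable (fun i : ℕ => z ^ q ^ i)) ∧
    (∀ z : F, ‖z‖ < 1 → ‖ASLog q z‖ < 1) ∧
    (∀ z w : F, ‖z‖ < 1 → ‖w‖ < 1 → ASLog q (z + w) = ASLog q z + ASLog q w) ∧
    (∀ c z : F, c ^ q = c → ‖z‖ < 1 → ASLog q (c * z) = c * ASLog q z) ∧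
    (∀ z : F, ‖z‖ < 1 → ‖ASLog q z‖ = ‖z‖) ∧
    (∀ z : F, ‖z‖ < 1 → ASLog q z - (ASLog q z) ^ q = z) ∧
    (∀ b : F, ‖b‖ < 1 → ASLog q (b - b ^ q) = b) := by
  subst hq
  have : Fact p.Prime := ⟨hp⟩
  have hq : 1 < p ^ s := Nat.one_lt_pow hs.ne' hp.one_lt
  have hlt (z : F) (hz : ‖z‖ < 1) : ‖ASLog (p ^ s) z‖ < 1 :=
    (norm_ASLog_le (zero_lt_one.trans hq) hz).trans_lt hz
  refine ⟨fun z hz => summable_pow_pow_of_norm_lt_one hq hz, hlt,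
    fun z w hz hw => ASLog_add s hq hz hw, fun c z hc _ => ASLog_mul_of_pow_eq hc z,
    fun z hz => ?_, fun z hz => ASLog_sub_pow_self s hq hz, fun b hb => ASLog_sub_pow s hq hb⟩
  rw [← norm_sub_pow_of_norm_lt_one hq (hlt z hz), ASLog_sub_pow_self s hq hz]
end

section
/- Let d ≥ 1 and z_1, …, z_d ∈ F with ‖z_j‖ < 1 for all j. Then the family (z_1^{q^{i_1}}⋯z_d^{q^{i_d}}) indexed by tuples of integers 0 ≤ i_1 ≤ ⋯ ≤ i_d is summable; writing S⋆_d(z_1,…,z_d) for its sum (with the convention S⋆_0 = 1), one has S⋆_d(z_1,…,z_d) − S⋆_d(z_1,…,z_d)^q = z_1 · S⋆_{d−1}(z_2,…,z_d). (This is the system of Artin–Schreier difference equations ℘(𝔏i⋆_{{0}^d}(Z_1,…,Z_d)) = Z_1·𝔏i⋆_{{0}^{d−1}}(Z_2,…,Z_d) for scalar arguments.) -/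
/-- `S⋆_d(z_1,…,z_d) = ∑_{0 ≤ i_1 ≤ ⋯ ≤ i_d} z_1^{q^{i_1}} ⋯ z_d^{q^{i_d}}`
(the value `𝔏i⋆_{{0}^d}(z_1,…,z_d)` of the paper); `S⋆_0 = 1`. -/
noncomputable def ScmplStar (q : ℕ) {F : Type*} [NormedField F] (d : ℕ) (z : Fin d → F) : F :=
  ∑' f : {f : Fin d → ℕ // Monotone f}, ∏ j, z j ^ q ^ (f.1 j)

/-- The product of finitely many nonnegative summable families is summable over all tuples. -/
theorem summable_fin_prod_of_nonneg (d : ℕ) (a : Fin d → ℕ → ℝ) (h0 : ∀ j i, 0 ≤ a j i)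
    (ha : ∀ j, Summable (a j)) : Summable (fun f : Fin d → ℕ => ∏ j, a j (f j)) := by
  induction d with
  | zero => exact Summable.of_finite
  | succ n ih =>
    rw [← (Fin.consEquiv (fun _ : Fin (n + 1) => ℕ)).summable_iff]
    refine ((ha 0).mul_of_nonneg (ih (fun j => a j.succ) (fun j => h0 j.succ)
      (fun j => ha j.succ)) (h0 0) fun f => Finset.prod_nonneg fun j _ => h0 j.succ _).congr ?_
    rintro ⟨i, f⟩
    simp [Fin.prod_univ_succ, Fin.consEquiv]

theorem summable_prod_pow_pow {F : Type*} [NormedField F] [CompleteSpace F] {q : ℕ} (hq : 1 < q)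
    (d : ℕ) (z : Fin d → F) (hz : ∀ j, ‖z j‖ < 1) :
    Summable (fun f : {f : Fin d → ℕ // Monotone f} => ∏ j, z j ^ q ^ (f.1 j)) := by
  refine Summable.of_norm ?_
  have h := summable_fin_prod_of_nonneg d (fun j i => ‖z j‖ ^ q ^ i)
    (fun j i => by positivity) fun j =>
      (summable_geometric_of_lt_one (norm_nonneg _) (hz j)).comp_injective
        (Nat.pow_right_injective hq)
  simpa [Function.comp_def, norm_prod, norm_pow] using
    h.comp_injective (Subtype.val_injective (p := fun f : Fin d → ℕ => Monotone f))

/-- A weakly increasing tuple either starts with `0` or is a shift of a weakly increasing tuple. -/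
def monotoneFinSuccEquiv (n : ℕ) :
    {g : Fin n → ℕ // Monotone g} ⊕ {f : Fin (n + 1) → ℕ // Monotone f} ≃
      {f : Fin (n + 1) → ℕ // Monotone f} where
  toFun := Sum.elim
    (fun g => ⟨Fin.cons 0 g.1, fun i j hij => by
      induction i using Fin.cases with
      | zero => simp
      | succ i =>
        induction j using Fin.cases with
        | zero => simp at hij
        | succ j => simpa using g.2 (Fin.succ_le_succ_iff.mp hij)⟩)
    (fun f => ⟨fun j => f.1 j + 1, fun _ _ hij => Nat.succ_le_succ (f.2 hij)⟩)
  invFun f := if f.1 0 = 0 then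
      Sum.inl ⟨fun j => f.1 j.succ, fun _ _ hij => f.2 (Fin.succ_le_succ_iff.mpr hij)⟩
    else Sum.inr ⟨fun j => f.1 j - 1, fun _ _ hij => Nat.sub_le_sub_right (f.2 hij) 1⟩
  left_inv := by rintro (g | f) <;> simp
  right_inv := by
    rintro ⟨f, hf⟩
    by_cases h : f 0 = 0
    · simp only [h, ↓reduceIte, Sum.elim_inl]
      refine Subtype.ext (funext fun j => ?_)
      induction j using Fin.cases <;> simp [h]
    · simp only [h, ↓reduceIte, Sum.elim_inr]
      refine Subtype.ext (funext fun j => ?_)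
      have := hf (Fin.zero_le j)
      dsimp only
      omega

theorem tsum_pow_expChar_pow {p : ℕ} (hp : p.Prime) (s : ℕ) {F ι : Type*} [NormedField F]
    [CharP F p] {u : ι → F} (hu : Summable u) :
    HasSum (fun i => u i ^ p ^ s) ((∑' i, u i) ^ p ^ s) := by
  have := Fact.mk hp
  have : ExpChar F p := ExpChar.prime hp
  have h := hu.hasSum.map (iterateFrobenius F p s) (continuous_pow (M := F) (p ^ s))
  simpa only [Function.comp_def, iterateFrobenius_def] using h

/-- For `‖z_j‖ < 1`, the family `(z_1^{q^{i_1}} ⋯ z_d^{q^{i_d}})` over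
weakly increasing tuples `0 ≤ i_1 ≤ ⋯ ≤ i_d` is summable, and the sums satisfy the
Artin–Schreier system `S⋆_d - S⋆_d^q = z_1 · S⋆_{d-1}(z_2,…,z_d)`. -/
theorem stmt_10 {p s q : ℕ} (hp : p.Prime) (hs : 0 < s) (hq : q = p ^ s)
    {F : Type*} [NormedField F] [CompleteSpace F] [IsUltrametricDist F] [CharP F p]
    (d : ℕ) (hd : 1 ≤ d) (z : Fin d → F) (hz : ∀ j, ‖z j‖ < 1) :
    Summable (fun f : {f : Fin d → ℕ // Monotone f} => ∏ j, z j ^ q ^ (f.1 j)) ∧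
    ScmplStar q d z - (ScmplStar q d z) ^ q =
      z ⟨0, hd⟩ *
        ScmplStar q (d - 1) (fun j => z ⟨j.1 + 1, by have := j.isLt; omega⟩) := by
  have hq1 : 1 < q := hq ▸ Nat.one_lt_pow hs.ne' hp.one_lt
  have hS := summable_prod_pow_pow hq1 d z hz
  refine ⟨hS, ?_⟩
  obtain ⟨n, rfl⟩ : ∃ n, d = n + 1 := ⟨d - 1, by omega⟩
  have hT := (summable_prod_pow_pow hq1 n (fun j => z j.succ) fun j => hz _).hasSum.mul_left (z 0)
  have hP := tsum_pow_expChar_pow hp s hS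
  rw [← hq] at hP
  have key : HasSum ((fun f : {f : Fin (n + 1) → ℕ // Monotone f} => ∏ j, z j ^ q ^ (f.1 j)) ∘
      monotoneFinSuccEquiv n) (z 0 * ScmplStar q n (fun j => z j.succ) +
        ScmplStar q (n + 1) z ^ q) := by
    unfold ScmplStar
    refine HasSum.sum ?_ ?_
    · convert! hT using 2 with g
      simp [monotoneFinSuccEquiv, Fin.prod_univ_succ]
    · convert! hP using 2 with f
      simp [monotoneFinSuccEquiv, ← Finset.prod_pow, pow_succ, pow_mul]
  rw [sub_eq_iff_eq_add]
  exact ((monotoneFinSuccEquiv n).hasSum_iff.mp key).tsum_eq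
end

section
/- Let d ≥ 1, n_1, …, n_d positive integers, and z_1, …, z_d ∈ F with ‖z_j‖ < ‖θ‖^{n_j·q/(q−1)} for all j, so that all the Carlitz multiple polylogarithms and star polylogarithms below converge. Then the Chang–Mishiba functional relation holds: Li_{n_1,…,n_d}(z_1,…,z_d) = ∑_{i=2}^{d} (−1)^i · Li⋆_{n_{i−1},…,n_1}(z_{i−1},…,z_1) · Li_{n_i,…,n_d}(z_i,…,z_d) + (−1)^{d+1} · Li⋆_{n_d,…,n_1}(z_d,…,z_1). -/
/-- The Carlitz multiple polylogarithm
`Li_{n_1,…,n_d}(z_1,…,z_d) = ∑_{0 ≤ i_1 < ⋯ < i_d} z_1^{q^{i_1}} ⋯ z_d^{q^{i_d}} /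
(L_{i_1}^{n_1} ⋯ L_{i_d}^{n_d})`, where `L_i = (θ-θ^q)⋯(θ-θ^{q^i})`. -/
noncomputable def CMPL (q : ℕ) {F : Type*} [NormedField F] (θ : F) (d : ℕ)
    (n : Fin d → ℕ) (z : Fin d → F) : F :=
  ∑' f : {f : Fin d → ℕ // StrictMono f},
    (∏ j, z j ^ q ^ (f.1 j)) /
      ∏ j, (∏ k ∈ Finset.Icc 1 (f.1 j), (θ - θ ^ q ^ k)) ^ (n j)

/-- The Carlitz multiple star polylogarithm: the same sum over `0 ≤ i_1 ≤ ⋯ ≤ i_d`. -/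
noncomputable def CMSPL (q : ℕ) {F : Type*} [NormedField F] (θ : F) (d : ℕ)
    (n : Fin d → ℕ) (z : Fin d → F) : F :=
  ∑' f : {f : Fin d → ℕ // Monotone f},
    (∏ j, z j ^ q ^ (f.1 j)) /
      ∏ j, (∏ k ∈ Finset.Icc 1 (f.1 j), (θ - θ ^ q ^ k)) ^ (n j)

theorem summable_norm_prod_pi {F : Type*} [NormedField F] (d : ℕ) (a : Fin d → ℕ → F)
    (ha : ∀ j, Summable fun i => ‖a j i‖) :
    Summable fun f : Fin d → ℕ => ‖∏ j, a j (f j)‖ := by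
  induction d with
  | zero => exact Summable.of_finite
  | succ d ih =>
    rw [← (Fin.consEquiv fun _ : Fin (d + 1) => ℕ).summable_iff]
    have h := (ha 0).mul_of_nonneg (ih (fun j => a j.succ) fun j => ha j.succ)
      (fun _ => norm_nonneg _) (fun _ => norm_nonneg _)
    refine h.congr fun x => ?_
    simp [Fin.prod_univ_succ, Fin.consEquiv]

/-- The tuple `f` is weakly decreasing on the indices below `k` and strictly increasing
on the indices from `k` on. -/
def DecThenInc {d : ℕ} (k : ℕ) (f : Fin d → ℕ) : Prop :=
  (∀ i j : Fin d, i ≤ j → j.1 < k → f j ≤ f i) ∧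
    ∀ i j : Fin d, k ≤ i.1 → i < j → f i < f j

theorem decThenInc_pred {d k : ℕ} {f : Fin d → ℕ} (hk : k + 1 < d) (h : DecThenInc (k + 1) f) :
    DecThenInc k f ↔ f ⟨k, by omega⟩ < f ⟨k + 1, hk⟩ := by
  refine ⟨fun h' => h'.2 _ _ le_rfl (Fin.mk_lt_mk.2 (by omega)), fun hlt => ⟨fun i j hij hj =>
    h.1 i j hij (by omega), fun i j hi hij => ?_⟩⟩
  rcases hi.eq_or_lt with rfl | hi
  · refine hlt.trans_le ?_
    rcases eq_or_ne j ⟨i.1 + 1, hk⟩ with rfl | hj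
    · exact le_rfl
    · refine (h.2 _ _ le_rfl ?_).le
      rw [Fin.lt_def] at hij ⊢
      have : j.1 ≠ i.1 + 1 := fun e => hj (Fin.ext e)
      simp only
      omega
  · exact h.2 i j hi hij

theorem decThenInc_succ {d k : ℕ} {f : Fin d → ℕ} (hk : k + 1 < d) (h : DecThenInc (k + 1) f) :
    DecThenInc (k + 2) f ↔ f ⟨k + 1, hk⟩ ≤ f ⟨k, by omega⟩ := by
  refine ⟨fun h' => h'.1 _ _ (Fin.mk_le_mk.2 (by omega)) (by simp), fun hle =>
    ⟨fun i j hij hj => ?_, fun i j hi hij => h.2 i j (by omega) hij⟩⟩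
  rcases (Nat.lt_succ_iff.1 hj).lt_or_eq with hj | hj
  · exact h.1 i j hij hj
  · obtain rfl : j = ⟨k + 1, hk⟩ := Fin.ext hj
    rcases hij.eq_or_lt with rfl | hij
    · exact le_rfl
    · exact hle.trans (h.1 _ _ (Fin.le_def.2 (Nat.lt_succ_iff.1 hij)) (by simp))

open Classical in
theorem sum_neg_one_pow_decThenInc {R : Type*} [CommRing R] {d : ℕ} (hd : 1 ≤ d)
    (f : Fin d → ℕ) (c : R) :
    ∑ k ∈ Finset.range (d + 1), (-1) ^ k * (if DecThenInc k f then c else 0) = 0 := by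
  have key : ∀ N < d, ∑ k ∈ Finset.range (N + 1), (-1) ^ k * (if DecThenInc k f then c else 0) =
      (-1) ^ N * (if DecThenInc N f ∧ DecThenInc (N + 1) f then c else 0) := by
    intro N
    induction N with
    | zero =>
      intro _
      have : DecThenInc 0 f → DecThenInc 1 f := fun h =>
        ⟨fun i j hij hj => by
          obtain rfl : i = j := Fin.ext (by rw [Fin.le_def] at hij; omega)
          exact le_rfl, fun i j _ hij => h.2 i j (Nat.zero_le _) hij⟩
      simp only [zero_add, Finset.sum_range_one, and_iff_left_of_imp this]
    | succ N ih =>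
      intro hN
      rw [Finset.sum_range_succ, ih (by omega), pow_succ]
      by_cases h : DecThenInc (N + 1) f
      · simp only [h, decThenInc_pred hN h, decThenInc_succ hN h, and_true, true_and, if_true,
          ← not_lt]
        split_ifs <;> simp_all
      · simp [h]
  obtain ⟨e, rfl⟩ : ∃ e, d = e + 1 := ⟨d - 1, by omega⟩
  rw [Finset.sum_range_succ, key e (by omega), pow_succ]
  have : DecThenInc (e + 1) f → DecThenInc e f := fun h =>
    ⟨fun i j hij hj => h.1 i j hij (by omega), fun i j hi hij => by
      rw [Fin.lt_def] at hij; omega⟩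
  by_cases h : DecThenInc (e + 1) f
  · simp [h, this h]
  · simp [h]

open Classical in
theorem tsum_monotone_mul_tsum_strictMono {F : Type*} [NormedField F] [CompleteSpace F]
    (a : ℕ → ℕ → F) (ha : ∀ j, Summable fun i => ‖a j i‖) (k m : ℕ) :
    (∑' f : {f : Fin k → ℕ // Monotone f}, ∏ j : Fin k, a j.rev (f.1 j)) *
      (∑' g : {g : Fin m → ℕ // StrictMono g}, ∏ j : Fin m, a (k + j) (g.1 j)) =
    ∑' h : Fin (k + m) → ℕ, if DecThenInc k h then ∏ j : Fin (k + m), a j (h j) else 0 := by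
  have hrev : (∑' f : {f : Fin k → ℕ // Monotone f}, ∏ j : Fin k, a j.rev (f.1 j)) =
      ∑' f : {f : Fin k → ℕ // Antitone f}, ∏ j : Fin k, a j (f.1 j) := by
    let e : {f : Fin k → ℕ // Monotone f} ≃ {f : Fin k → ℕ // Antitone f} :=
      (Equiv.arrowCongr Fin.revPerm (Equiv.refl ℕ)).subtypeEquiv fun f =>
        ⟨fun h i j hij => h (Fin.rev_le_rev.2 hij), fun h i j hij => by
          simpa using h (Fin.rev_le_rev.2 hij)⟩
    rw [← e.tsum_eq]
    refine tsum_congr fun f => ?_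
    rw [← Equiv.prod_comp Fin.revPerm]
    simp [e]
  have hA := summable_norm_prod_pi k (fun j => a j) fun j => ha j
  have hB := summable_norm_prod_pi m (fun j => a (k + j)) fun j => ha _
  rw [hrev]
  refine (tsum_mul_tsum_of_summable_norm (hA.subtype {f | Antitone f})
    (hB.subtype {g | StrictMono g})).trans ?_
  let e : {f : Fin k → ℕ // Antitone f} × {g : Fin m → ℕ // StrictMono g} → (Fin (k + m) → ℕ) :=
    fun x => Fin.appendEquiv k m (x.1.1, x.2.1)
  have he : Function.Injective e := (Fin.appendEquiv k m).injective.comp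
    (Subtype.val_injective.prodMap Subtype.val_injective)
  have hdec (f : Fin k → ℕ) (g : Fin m → ℕ) (hf : Antitone f) (hg : StrictMono g) :
      DecThenInc k (Fin.append f g) := by
    constructor <;> intro i j hi hj <;> induction i using Fin.addCases <;>
      induction j using Fin.addCases
    all_goals simp only [Fin.append_left, Fin.append_right, Fin.le_def, Fin.lt_def,
      Fin.val_castAdd, Fin.val_natAdd] at hi hj ⊢
    all_goals first
      | omega
      | exact hf (Fin.le_def.2 hi)
      | exact hg (Fin.lt_def.2 (by omega))
  rw [← he.tsum_eq]
  · refine tsum_congr fun x => ?_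
    refine Eq.trans ?_ (if_pos (hdec _ _ x.1.2 x.2.2)).symm
    simp [e, Fin.appendEquiv, Fin.prod_univ_add]
  · intro h hh
    have hP : DecThenInc k h := by
      by_contra hP
      simp [hP] at hh
    exact ⟨(⟨fun i => h (Fin.castAdd m i), fun i j hij => hP.1 _ _ hij j.2⟩,
      ⟨fun i => h (Fin.natAdd k i), fun i j hij => hP.2 _ _ (Nat.le_add_right _ _)
        ((Fin.natAdd_lt_natAdd_iff k).2 hij)⟩), (Fin.appendEquiv k m).apply_symm_apply h⟩

theorem alternating_sum_tsum_monotone_mul_tsum_strictMono {F : Type*} [NormedField F]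
    [CompleteSpace F] (a : ℕ → ℕ → F) (ha : ∀ j, Summable fun i => ‖a j i‖) {d : ℕ}
    (hd : 1 ≤ d) :
    ∑ k ∈ Finset.range (d + 1), (-1) ^ k *
      ((∑' f : {f : Fin k → ℕ // Monotone f}, ∏ j : Fin k, a j.rev (f.1 j)) *
        ∑' g : {g : Fin (d - k) → ℕ // StrictMono g}, ∏ j : Fin (d - k), a (k + j) (g.1 j)) =
      0 := by
  classical
  have hs := summable_norm_prod_pi d (fun j => a j) fun j => ha j
  have hk : ∀ k ∈ Finset.range (d + 1), (-1) ^ k *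
      ((∑' f : {f : Fin k → ℕ // Monotone f}, ∏ j : Fin k, a j.rev (f.1 j)) *
        ∑' g : {g : Fin (d - k) → ℕ // StrictMono g}, ∏ j : Fin (d - k), a (k + j) (g.1 j)) =
      ∑' h : Fin d → ℕ, (-1) ^ k * if DecThenInc k h then ∏ j : Fin d, a j (h j) else 0 := by
    intro k hk
    obtain ⟨m, rfl⟩ := Nat.exists_eq_add_of_le (Finset.mem_range_succ_iff.1 hk)
    rw [Nat.add_sub_cancel_left, tsum_monotone_mul_tsum_strictMono a ha, tsum_mul_left]
  rw [Finset.sum_congr rfl hk, ← Summable.tsum_finsetSum]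
  · simp_rw [sum_neg_one_pow_decThenInc hd]
    exact tsum_zero
  · intro k _
    exact (hs.of_norm.indicator {h | DecThenInc k h}).mul_left _

theorem norm_sub_pow_eq {F : Type*} [NormedField F] [IsUltrametricDist F] {θ : F} (hθ : 1 < ‖θ‖)
    {m : ℕ} (hm : 1 < m) : ‖θ - θ ^ m‖ = ‖θ‖ ^ m := by
  have h : ‖θ‖ < ‖θ ^ m‖ := by
    rw [norm_pow]
    simpa using pow_lt_pow_right₀ hθ hm
  rw [sub_eq_add_neg, IsUltrametricDist.norm_add_eq_max_of_norm_ne_norm (by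
    rw [norm_neg]; exact h.ne), norm_neg, max_eq_right h.le, norm_pow]

theorem norm_prod_sub_pow_mul {F : Type*} [NormedField F] [IsUltrametricDist F] {θ : F}
    (hθ : 1 < ‖θ‖) {q : ℕ} (hq : 1 < q) (i : ℕ) :
    ‖∏ k ∈ Finset.Icc 1 i, (θ - θ ^ q ^ k)‖ * ‖θ‖ ^ ((q : ℝ) / (q - 1)) =
      (‖θ‖ ^ ((q : ℝ) / (q - 1))) ^ q ^ i := by
  have h0 : 0 < ‖θ‖ := one_pos.trans hθ
  have hq1 : (q : ℝ) - 1 ≠ 0 := by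
    have : (1 : ℝ) < q := by exact_mod_cast hq
    linarith
  have hB : (‖θ‖ ^ ((q : ℝ) / (q - 1))) ^ q = ‖θ‖ ^ ((q : ℝ) / (q - 1)) * ‖θ‖ ^ q := by
    rw [← Real.rpow_natCast, ← Real.rpow_mul h0.le, ← Real.rpow_natCast ‖θ‖, ← Real.rpow_add h0]
    congr 1
    field_simp
    ring
  induction i with
  | zero => simp
  | succ i ih =>
    rw [Finset.prod_Icc_succ_top (by omega), norm_mul,
      norm_sub_pow_eq hθ (Nat.one_lt_pow (by omega) hq), mul_right_comm, ih, pow_succ' q i,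
      pow_mul, pow_mul, hB, mul_pow]

theorem summable_norm_polylog_term {F : Type*} [NormedField F] [IsUltrametricDist F] {θ : F}
    (hθ : 1 < ‖θ‖) {q : ℕ} (hq : 1 < q) (n : ℕ) (z : F)
    (hz : ‖z‖ < ‖θ‖ ^ (((n : ℝ) * q) / ((q : ℝ) - 1))) :
    Summable fun i : ℕ => ‖z ^ q ^ i / (∏ k ∈ Finset.Icc 1 i, (θ - θ ^ q ^ k)) ^ n‖ := by
  have h0 : 0 < ‖θ‖ := one_pos.trans hθ
  set B := ‖θ‖ ^ ((q : ℝ) / (q - 1)) with hBdef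
  have hB : 0 < B := Real.rpow_pos_of_pos h0 _
  have hzB : ‖z‖ < B ^ n := by
    rwa [hBdef, ← Real.rpow_natCast, ← Real.rpow_mul h0.le, div_mul_eq_mul_div, mul_comm (q : ℝ)]
  have hr : ‖z‖ / B ^ n < 1 := (div_lt_one (pow_pos hB n)).2 hzB
  have hr0 : 0 ≤ ‖z‖ / B ^ n := by positivity
  refine Summable.of_nonneg_of_le (fun _ => norm_nonneg _) (fun i => ?_)
    ((summable_geometric_of_lt_one hr0 hr).mul_left (B ^ n))
  have hL := norm_prod_sub_pow_mul hθ hq i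
  rw [← hBdef] at hL
  rw [norm_div, norm_pow, norm_pow, eq_div_of_mul_eq hB.ne' hL]
  calc ‖z‖ ^ q ^ i / (B ^ q ^ i / B) ^ n = B ^ n * (‖z‖ / B ^ n) ^ q ^ i := by
        rw [div_pow, div_pow, ← pow_mul, ← pow_mul, mul_comm n]
        field_simp
    _ ≤ B ^ n * (‖z‖ / B ^ n) ^ i := by
        gcongr B ^ n * ?_
        exact pow_le_pow_of_le_one hr0 hr.le (Nat.lt_pow_self hq).le

/-- the Chang–Mishiba functional relation
`Li_{n_1,…,n_d}(z_1,…,z_d) = ∑_{i=2}^{d} (−1)^i Li⋆_{n_{i−1},…,n_1}(z_{i−1},…,z_1) ·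
Li_{n_i,…,n_d}(z_i,…,z_d) + (−1)^{d+1} Li⋆_{n_d,…,n_1}(z_d,…,z_1)` on the polydisk of
convergence. (The sum over `i ∈ {2,…,d}` is reindexed by `k = i − 2 ∈ Fin (d−1)`.) -/
theorem stmt_17 {p s q : ℕ} (hp : p.Prime) (hs : 0 < s) (hq : q = p ^ s)
    {F : Type*} [NormedField F] [CompleteSpace F] [IsUltrametricDist F] [CharP F p]
    (θ : F) (hθ : 1 < ‖θ‖) (d : ℕ) (hd : 1 ≤ d)
    (n : Fin d → ℕ) (hn : ∀ j, 1 ≤ n j) (z : Fin d → F)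
    (hz : ∀ j, ‖z j‖ < ‖θ‖ ^ (((n j : ℝ) * q) / ((q : ℝ) - 1))) :
    CMPL q θ d n z =
      (∑ k : Fin (d - 1), (-1 : F) ^ (k.1 + 2) *
        CMSPL q θ (k.1 + 1)
          (fun j => n ⟨k.1 - j.1, by have := k.isLt; have := j.isLt; omega⟩)
          (fun j => z ⟨k.1 - j.1, by have := k.isLt; have := j.isLt; omega⟩) *
        CMPL q θ (d - k.1 - 1)
          (fun j => n ⟨k.1 + 1 + j.1, by have := k.isLt; have := j.isLt; omega⟩)
          (fun j => z ⟨k.1 + 1 + j.1, by have := k.isLt; have := j.isLt; omega⟩)) +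
      (-1 : F) ^ (d + 1) *
        CMSPL q θ d
          (fun j => n ⟨d - 1 - j.1, by have := j.isLt; omega⟩)
          (fun j => z ⟨d - 1 - j.1, by have := j.isLt; omega⟩) := by
  have hq1 : 1 < q := hq ▸ Nat.one_lt_pow hs.ne' hp.one_lt
  obtain ⟨e, rfl⟩ : ∃ e, d = e + 1 := ⟨d - 1, by omega⟩
  let a : ℕ → ℕ → F := fun j i => if h : j < e + 1 then
    z ⟨j, h⟩ ^ q ^ i / (∏ k ∈ Finset.Icc 1 i, (θ - θ ^ q ^ k)) ^ n ⟨j, h⟩ else 0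
  have a_eq : ∀ (j i : ℕ) (h : j < e + 1), a j i =
      z ⟨j, h⟩ ^ q ^ i / (∏ k ∈ Finset.Icc 1 i, (θ - θ ^ q ^ k)) ^ n ⟨j, h⟩ :=
    fun j i h => dif_pos h
  have ha : ∀ j, Summable fun i => ‖a j i‖ := fun j => by
    by_cases h : j < e + 1
    · simpa only [a_eq j _ h] using summable_norm_polylog_term hθ hq1 _ _ (hz ⟨j, h⟩)
    · simp only [a, dif_neg h, norm_zero, summable_zero]
  have star_eq (k : ℕ) (hk : k < e + 1) : (∑' f : {f : Fin (k + 1) → ℕ // Monotone f},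
      ∏ j : Fin (k + 1), a j.rev (f.1 j)) = CMSPL q θ (k + 1) (fun j => n ⟨k - j.1, by omega⟩)
        (fun j => z ⟨k - j.1, by omega⟩) := by
    refine tsum_congr fun f => ?_
    rw [← Finset.prod_div_distrib]
    refine Finset.prod_congr rfl fun j _ => ?_
    have hj : (j.rev : ℕ) = k - j.1 := by simp [Fin.val_rev]
    rw [hj, a_eq]
  have li_eq (k m : ℕ) (h : k + m ≤ e + 1) : (∑' g : {g : Fin m → ℕ // StrictMono g},
      ∏ j : Fin m, a (k + j) (g.1 j)) = CMPL q θ m (fun j => n ⟨k + j.1, by omega⟩)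
        (fun j => z ⟨k + j.1, by omega⟩) := by
    refine tsum_congr fun g => ?_
    rw [← Finset.prod_div_distrib]
    exact Finset.prod_congr rfl fun j _ => a_eq _ _ _
  have hzero (b : ℕ → ℕ → F) :
      ∑' f : {f : Fin 0 → ℕ // Monotone f}, ∏ j : Fin 0, b j.rev (f.1 j) = 1 := by
    have : Unique {f : Fin 0 → ℕ // Monotone f} :=
      ⟨⟨⟨Fin.elim0, fun i => i.elim0⟩⟩, fun f => Subtype.ext (Subsingleton.elim _ _)⟩
    simp [tsum_fintype]
  have hone (b : ℕ → ℕ → F) :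
      ∑' f : {f : Fin 0 → ℕ // StrictMono f}, ∏ j : Fin 0, b (e + 1 + j) (f.1 j) = 1 := by
    have : Unique {f : Fin 0 → ℕ // StrictMono f} :=
      ⟨⟨⟨Fin.elim0, fun i => i.elim0⟩⟩, fun f => Subtype.ext (Subsingleton.elim _ _)⟩
    simp [tsum_fintype]
  have hX := alternating_sum_tsum_monotone_mul_tsum_strictMono a ha hd
  rw [Finset.sum_range_succ, Finset.sum_range_succ', ← Fin.sum_univ_eq_sum_range
    (fun k => (-1) ^ (k + 1) * (_ * _)), hzero, Nat.sub_self, hone, star_eq e e.lt_succ_self,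
    Nat.sub_zero, li_eq 0 (e + 1) (zero_add _).le] at hX
  simp only [pow_zero, one_mul, mul_one] at hX
  have hshift : CMPL q θ (e + 1) (fun j => n ⟨0 + j.1, by omega⟩)
      (fun j => z ⟨0 + j.1, by omega⟩) = CMPL q θ (e + 1) n z := by
    simp only [Nat.zero_add, Fin.eta]
  rw [hshift, add_right_comm] at hX
  rw [eq_neg_of_add_eq_zero_right hX, neg_add, ← Finset.sum_neg_distrib]
  refine congrArg₂ _ (Finset.sum_congr rfl fun k _ => ?_) ?_
  · have h := k.isLt
    rw [Nat.sub_add_eq (e + 1) k.1 1, star_eq k (by omega), li_eq (k + 1) _ (by omega)]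
    ring
  · rw [pow_succ _ (e + 1)]
    simp
end
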